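/- Let (H,R) be a finite-dimensional semisimple and cosemisimple quasi-triangular Hopf algebra over a field k. Then there is a unique decomposition H_R = D₁ ⊕ ⋯ ⊕ D_r of H_R into minimal H-adjoint-stable subcoalgebras D₁,…,D_r, and this is also the decomposition of H, viewed as a left-left Yetter-Drinfeld module over itself via the adjoint action ·_ad and the coproduct Δ, into a direct sum of irreducible Yetter-Drinfeld submodules. -/

import Mathlib

open TensorProduct LinearMap

variable (K : Type) [Field K] (H : Type) [Ring H] [HopfAlgebra K H]

/-- The left adjoint action as a linear map `H ⊗ H →ₗ H`, `h ⊗ a ↦ Σ h₍₁₎ * a * S(h₍₂₎)`. -/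
noncomputable def adMap : H ⊗[K] H →ₗ[K] H :=
  (LinearMap.mul' K H) ∘ₗ
    (LinearMap.lTensor H ((LinearMap.mul' K H) ∘ₗ
      (LinearMap.lTensor H (HopfAlgebra.antipode (R := K))) ∘ₗ
      (TensorProduct.comm K H H).toLinearMap)) ∘ₗ
    (TensorProduct.assoc K H H H).toLinearMap ∘ₗ
    (LinearMap.rTensor H (Coalgebra.comul (R := K)))

/-- `h ·_ad a = Σ h₍₁₎ a S(h₍₂₎)`. -/
noncomputable def adAct (h a : H) : H := adMap K H (h ⊗ₜ a)

/-- `R¹² = Σ r¹ ⊗ r² ⊗ 1` in `H ⊗ (H ⊗ H)`. -/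
noncomputable def r12 (R : H ⊗[K] H) : H ⊗[K] (H ⊗[K] H) :=
  TensorProduct.map LinearMap.id ((TensorProduct.mk K H H).flip 1) R

/-- `R¹³ = Σ r¹ ⊗ 1 ⊗ r²` in `H ⊗ (H ⊗ H)`. -/
noncomputable def r13 (R : H ⊗[K] H) : H ⊗[K] (H ⊗[K] H) :=
  TensorProduct.map LinearMap.id (TensorProduct.mk K H H 1) R

/-- `R²³ = 1 ⊗ R` in `H ⊗ (H ⊗ H)`. -/
noncomputable def r23 (R : H ⊗[K] H) : H ⊗[K] (H ⊗[K] H) := (1 : H) ⊗ₜ R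

/-- `(H,R)` is a quasi-triangular Hopf algebra: `R` is invertible,
`R Δ(h) = Δᶜᵒᵖ(h) R`, `(Δ⊗id)(R) = R¹³R²³` and `(id⊗Δ)(R) = R¹³R¹²`. -/
structure IsQuasiTriangular (R : H ⊗[K] H) : Prop where
  isUnit : IsUnit R
  intertwine : ∀ h : H, R * Coalgebra.comul h =
    (TensorProduct.comm K H H) (Coalgebra.comul h) * R
  comul_rTensor : (TensorProduct.assoc K H H H)
      ((LinearMap.rTensor H (Coalgebra.comul (R := K))) R) = r13 K H R * r23 K H R
  comul_lTensor : (LinearMap.lTensor H (Coalgebra.comul (R := K))) R = r13 K H R * r12 K H R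

/-- The comultiplication `Δ_R` of the transmuted braided group `H_R`:
`Δ_R(h) = Σ h₍₁₎ S(R²) ⊗ R¹ ·_ad h₍₂₎`. -/
noncomputable def deltaR (R : H ⊗[K] H) : H →ₗ[K] H ⊗[K] H :=
  (TensorProduct.map
      ((LinearMap.mul' K H) ∘ₗ (LinearMap.lTensor H (HopfAlgebra.antipode (R := K))))
      ((adMap K H) ∘ₗ (TensorProduct.comm K H H).toLinearMap)) ∘ₗ
    (TensorProduct.tensorTensorTensorComm K H H H H).toLinearMap ∘ₗ
    (LinearMap.lTensor (H ⊗[K] H) (TensorProduct.comm K H H).toLinearMap) ∘ₗ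
    ((TensorProduct.mk K (H ⊗[K] H) (H ⊗[K] H)).flip R) ∘ₗ
    (Coalgebra.comul (R := K))

/-- A subcoalgebra of `(H, Δ)`. -/
def IsSubcoalgebra (D : Submodule K H) : Prop :=
  ∀ a ∈ D, Coalgebra.comul (R := K) a ∈ Submodule.map₂ (TensorProduct.mk K H H) D D

/-- A simple (nonzero, minimal) subcoalgebra of `(H, Δ)`. -/
def IsSimpleSubcoalgebra (D : Submodule K H) : Prop :=
  D ≠ ⊥ ∧ IsSubcoalgebra K H D ∧
    ∀ D' : Submodule K H, D' ≤ D → IsSubcoalgebra K H D' → D' = ⊥ ∨ D' = D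

/-- `H` is a cosemisimple coalgebra: the sum of its simple subcoalgebras is everything. -/
def IsCosemisimpleCoalgebra : Prop :=
  sSup {D : Submodule K H | IsSimpleSubcoalgebra K H D} = ⊤

/-- A subcoalgebra of the transmuted braided group `(H, Δ_R)`. -/
def IsSubcoalgebraR (R : H ⊗[K] H) (D : Submodule K H) : Prop :=
  ∀ a ∈ D, deltaR K H R a ∈ Submodule.map₂ (TensorProduct.mk K H H) D D

/-- A simple (nonzero, minimal) subcoalgebra of `(H, Δ_R)`. -/
def IsSimpleSubcoalgebraR (R : H ⊗[K] H) (D : Submodule K H) : Prop :=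
  D ≠ ⊥ ∧ IsSubcoalgebraR K H R D ∧
    ∀ D' : Submodule K H, D' ≤ D → IsSubcoalgebraR K H R D' → D' = ⊥ ∨ D' = D

/-- The coalgebra `(H, Δ_R)` is cosemisimple: it is the sum of its simple subcoalgebras. -/
def IsCosemisimpleR (R : H ⊗[K] H) : Prop :=
  sSup {D : Submodule K H | IsSimpleSubcoalgebraR K H R D} = ⊤

/-- A Yetter–Drinfeld submodule of `H` (with the adjoint action and the coproduct):
a subspace stable under `·_ad` and a left subcomodule for `Δ`, i.e. `Δ(D) ⊆ H ⊗ D`. -/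
def IsYDSubmodule (D : Submodule K H) : Prop :=
  (∀ (h : H), ∀ a ∈ D, adAct K H h a ∈ D) ∧
  (∀ a ∈ D, Coalgebra.comul (R := K) a ∈ Submodule.map₂ (TensorProduct.mk K H H) ⊤ D)

/-- A minimal (irreducible) Yetter–Drinfeld submodule of `H`. -/
def IsMinimalYDSubmodule (D : Submodule K H) : Prop :=
  D ≠ ⊥ ∧ IsYDSubmodule K H D ∧
    ∀ D' : Submodule K H, D' ≤ D → IsYDSubmodule K H D' → D' = ⊥ ∨ D' = D

/-- An `H`-adjoint-stable subcoalgebra of the transmuted braided group `H_R`: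
a subcoalgebra of `(H, Δ_R)` which is stable under the left adjoint action. -/
def IsAdjointStableSubcoalgebra (R : H ⊗[K] H) (D : Submodule K H) : Prop :=
  (∀ (h : H), ∀ a ∈ D, adAct K H h a ∈ D) ∧
  (∀ a ∈ D, deltaR K H R a ∈ Submodule.map₂ (TensorProduct.mk K H H) D D)

/-- A minimal (nonzero) `H`-adjoint-stable subcoalgebra of `H_R`. -/
def IsMinimalAdjointStableSubcoalgebra (R : H ⊗[K] H) (D : Submodule K H) : Prop :=
  D ≠ ⊥ ∧ IsAdjointStableSubcoalgebra K H R D ∧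
    ∀ D' : Submodule K H, D' ≤ D → IsAdjointStableSubcoalgebra K H R D' → D' = ⊥ ∨ D' = D

section Convolution

open Coalgebra WithConv

variable {K : Type} [Field K] {H : Type} [Ring H] [HopfAlgebra K H]
variable {A B : Type} [Ring A] [Algebra K A] [Ring B] [Algebra K B]

/-- The convolution product of linear maps out of `H`. -/
noncomputable def conv (f g : H →ₗ[K] A) : H →ₗ[K] A := (toConv f * toConv g).ofConv

/-- The unit of the convolution product. -/
noncomputable def convUnit (K H A : Type) [Field K] [Ring H] [HopfAlgebra K H]
    [Ring A] [Algebra K A] : H →ₗ[K] A := Algebra.linearMap K A ∘ₗ counit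

lemma conv_apply {ι : Type*} {h : H} (𝓡 : Repr K h ι) (f g : H →ₗ[K] A) :
    conv f g h = ∑ i ∈ 𝓡.index, f (𝓡.left i) * g (𝓡.right i) :=
  𝓡.convMul_apply (toConv f) (toConv g)

lemma convUnit_apply (h : H) : convUnit K H A h = algebraMap K A (counit h) := rfl

lemma conv_assoc (f g k : H →ₗ[K] A) : conv (conv f g) k = conv f (conv g k) :=
  congrArg ofConv (mul_assoc (toConv f) (toConv g) (toConv k))

lemma convUnit_conv (f : H →ₗ[K] A) : conv (convUnit K H A) f = f :=
  congrArg ofConv (one_mul (toConv f))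

lemma conv_convUnit (f : H →ₗ[K] A) : conv f (convUnit K H A) = f :=
  congrArg ofConv (mul_one (toConv f))

lemma comp_conv (φ : A →ₐ[K] B) (f g : H →ₗ[K] A) :
    φ.toLinearMap ∘ₗ conv f g = conv (φ.toLinearMap ∘ₗ f) (φ.toLinearMap ∘ₗ g) := by
  ext h
  simp [conv_apply (ℛ K h)]

lemma comp_convUnit (φ : A →ₐ[K] B) :
    φ.toLinearMap ∘ₗ convUnit K H A = convUnit K H B := by
  ext h
  simp [convUnit_apply]

lemma antipode_conv_id : conv (HopfAlgebra.antipode K) LinearMap.id = convUnit K H H :=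
  congrArg ofConv (LinearMap.antipode_mul_id (R := K) (C := H))

lemma antipode_conv_algHom (i : H →ₐ[K] A) :
    conv (i.toLinearMap ∘ₗ HopfAlgebra.antipode K) i.toLinearMap = convUnit K H A := by
  have := congrArg (i.toLinearMap ∘ₗ ·) (antipode_conv_id (K := K) (H := H))
  simpa only [comp_conv, comp_convUnit, LinearMap.comp_id] using this

/-- The antipode reverses the comultiplication, as an identity of convolution products. -/
lemma comul_comp_antipode :
    comul (R := K) (A := H) ∘ₗ HopfAlgebra.antipode K =
      conv (Algebra.TensorProduct.includeRight.toLinearMap ∘ₗ HopfAlgebra.antipode K)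
        (Algebra.TensorProduct.includeLeft.toLinearMap ∘ₗ HopfAlgebra.antipode K) := by
  let i₁ : H →ₐ[K] H ⊗[K] H := Algebra.TensorProduct.includeLeft
  let i₂ : H →ₐ[K] H ⊗[K] H := Algebra.TensorProduct.includeRight
  let S : H →ₗ[K] H := HopfAlgebra.antipode K
  let G : H →ₗ[K] H ⊗[K] H := conv (i₂.toLinearMap ∘ₗ S) (i₁.toLinearMap ∘ₗ S)
  have hΔ : conv i₁.toLinearMap i₂.toLinearMap = comul (R := K) (A := H) := by
    ext h
    simp [conv_apply (ℛ K h), i₁, i₂, (ℛ K h).eq]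
  have hG : conv G (comul (R := K)) = convUnit K H (H ⊗[K] H) := by
    rw [← hΔ, conv_assoc, ← conv_assoc _ i₁.toLinearMap, antipode_conv_algHom, convUnit_conv,
      antipode_conv_algHom]
  have hF : conv (comul (R := K)) (comul (R := K) ∘ₗ S) = convUnit K H (H ⊗[K] H) :=
    congrArg ofConv (LinearMap.comul_right_inv (R := K) (C := H))
  change comul (R := K) ∘ₗ S = G
  rw [← convUnit_conv (comul (R := K) ∘ₗ S), ← hG, conv_assoc, hF, conv_convUnit]

/-- The antipode reverses the comultiplication. -/
lemma comul_antipode (h : H) :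
    comul (R := K) (HopfAlgebra.antipode K h) =
      TensorProduct.map (HopfAlgebra.antipode K) (HopfAlgebra.antipode K)
        (TensorProduct.comm K H H (comul h)) := by
  have := LinearMap.congr_fun (comul_comp_antipode (K := K) (H := H)) h
  rw [LinearMap.comp_apply] at this
  rw [this]
  conv_rhs => rw [← (ℛ K h).eq]
  simp [conv_apply (ℛ K h)]

variable {M N P : Type} [AddCommGroup M] [Module K M] [AddCommGroup N] [Module K N]
  [AddCommGroup P] [Module K P]

/-- `G` intertwines the operators `f h` on `M` with the operators `g h` on `N`. -/
def Intertwines (G : M →ₗ[K] N) (f : H →ₗ[K] Module.End K M) (g : H →ₗ[K] Module.End K N) :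
    Prop :=
  ∀ h x, G (f h x) = g h (G x)

lemma Intertwines.conv {G : M →ₗ[K] N} {f f' : H →ₗ[K] Module.End K M}
    {g g' : H →ₗ[K] Module.End K N} (hf : Intertwines G f g) (hf' : Intertwines G f' g') :
    Intertwines G (conv f f') (conv g g') := by
  intro h x
  simp [conv_apply (ℛ K h), hf _ _, hf' _ _]

lemma Intertwines.comp {G : M →ₗ[K] N} {G' : N →ₗ[K] P} {f : H →ₗ[K] Module.End K M}
    {g : H →ₗ[K] Module.End K N} {k : H →ₗ[K] Module.End K P}
    (hG' : Intertwines G' g k) (hG : Intertwines G f g) : Intertwines (G' ∘ₗ G) f k := by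
  intro h x
  simp [hG _ _, hG' _ _]

end Convolution

section Adjoint

open Coalgebra

variable (K : Type) [Field K] (H : Type) [Ring H] [HopfAlgebra K H]

/-- Left multiplication by `h`. -/
noncomputable def leftMul : H →ₗ[K] Module.End K H := LinearMap.mul K H

/-- Right multiplication by `S(h)`. -/
noncomputable def rightMulAntipode : H →ₗ[K] Module.End K H :=
  (LinearMap.mul K H).flip ∘ₗ HopfAlgebra.antipode K

/-- The left adjoint action as a map into the endomorphism algebra. -/
noncomputable def adEnd : H →ₗ[K] Module.End K H := conv (leftMul K H) (rightMulAntipode K H)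

/-- Endomorphisms acting on the first tensor factor. -/
noncomputable def onFst : Module.End K H →ₐ[K] Module.End K (H ⊗[K] H) :=
  AlgHom.ofLinearMap (LinearMap.rTensorHom H) (LinearMap.rTensor_id _ _)
    (fun f g => LinearMap.rTensor_mul _ f g)

/-- Endomorphisms acting on the second tensor factor. -/
noncomputable def onSnd : Module.End K H →ₐ[K] Module.End K (H ⊗[K] H) :=
  AlgHom.ofLinearMap (LinearMap.lTensorHom H) (LinearMap.lTensor_id _ _)
    (fun f g => LinearMap.lTensor_mul _ f g)

/-- The action `h · (a ⊗ b) = Σ h₍₁₎ a S(h₍₃₎) ⊗ h₍₂₎ ·_ad b` on `H ⊗ H`. -/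
noncomputable def adEndTensor : H →ₗ[K] Module.End K (H ⊗[K] H) :=
  conv ((onFst K H).toLinearMap ∘ₗ leftMul K H)
    (conv ((onSnd K H).toLinearMap ∘ₗ adEnd K H)
      ((onFst K H).toLinearMap ∘ₗ rightMulAntipode K H))

variable {K H}

@[simp] lemma leftMul_apply (h a : H) : leftMul K H h a = h * a := rfl

@[simp] lemma rightMulAntipode_apply (h a : H) :
    rightMulAntipode K H h a = a * HopfAlgebra.antipode K h := rfl

@[simp] lemma onFst_tmul (f : Module.End K H) (a b : H) :
    onFst K H f (a ⊗ₜ b) = f a ⊗ₜ b := rfl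

@[simp] lemma onSnd_tmul (f : Module.End K H) (a b : H) :
    onSnd K H f (a ⊗ₜ b) = a ⊗ₜ f b := rfl

lemma adEnd_apply {ι : Type*} {h : H} (𝓡 : Repr K h ι) (a : H) :
    adEnd K H h a = ∑ i ∈ 𝓡.index, 𝓡.left i * a * HopfAlgebra.antipode K (𝓡.right i) := by
  simp [adEnd, conv_apply 𝓡, mul_assoc]

lemma adMap_tmul (h a : H) : adMap K H (h ⊗ₜ a) = adEnd K H h a := by
  rw [adEnd_apply (ℛ K h)]
  simp [adMap, ← (ℛ K h).eq, TensorProduct.sum_tmul, mul_assoc]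

lemma adAct_eq (h a : H) : adAct K H h a = adEnd K H h a := adMap_tmul h a

lemma adEnd_one : adEnd K H 1 = 1 := by
  ext a
  simp [← adMap_tmul, adMap, Algebra.TensorProduct.one_def]

lemma adEnd_mul (h k : H) : adEnd K H (h * k) = adEnd K H h * adEnd K H k := by
  ext a
  simp only [Module.End.mul_apply]
  rw [adEnd_apply ((ℛ K h).mul (ℛ K k)), adEnd_apply (ℛ K h), adEnd_apply (ℛ K k)]
  simp [Finset.sum_product, Finset.mul_sum, Finset.sum_mul,
    HopfAlgebra.antipode_mul_antidistrib, mul_assoc]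

/-- The comultiplication is compatible with the adjoint action (the Yetter-Drinfeld condition). -/
lemma intertwines_comul : Intertwines (comul (R := K) (A := H)) (adEnd K H) (adEndTensor K H) := by
  intro h x
  set ℓ₁ := (onFst K H).toLinearMap ∘ₗ leftMul K H
  set ℓ₂ := (onSnd K H).toLinearMap ∘ₗ leftMul K H
  set r₁ := (onFst K H).toLinearMap ∘ₗ rightMulAntipode K H
  set r₂ := (onSnd K H).toLinearMap ∘ₗ rightMulAntipode K H
  have hE : adEndTensor K H = conv (conv ℓ₁ ℓ₂) (conv r₂ r₁) := by
    rw [adEndTensor, adEnd, comp_conv]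
    simp only [conv_assoc, ℓ₁, ℓ₂, r₁, r₂]
  have hl (a : H) (z : H ⊗[K] H) : conv ℓ₁ ℓ₂ a z = comul a * z := by
    rw [conv_apply (ℛ K a), ← (ℛ K a).eq]
    induction z with
    | zero => simp
    | add z w hz hw => simp only [map_add, hz, hw, mul_add]
    | tmul b c => simp [ℓ₁, ℓ₂, Finset.sum_mul]
  have hr (a : H) (z : H ⊗[K] H) :
      conv r₂ r₁ a z = z * comul (HopfAlgebra.antipode K a) := by
    rw [conv_apply (ℛ K a), comul_antipode, ← (ℛ K a).eq]
    induction z with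
    | zero => simp
    | add z w hz hw => simp only [map_add, hz, hw, add_mul]
    | tmul b c => simp [r₁, r₂, Finset.mul_sum]
  rw [hE, conv_apply (ℛ K h), adEnd_apply (ℛ K h)]
  simp [hl, hr, mul_assoc]

end Adjoint

section Integrals

open Coalgebra

/-- A semisimple augmented algebra has a normalized left integral. -/
lemma exists_left_integral {K A : Type} [Field K] [Ring A] [Algebra K A] [IsSemisimpleRing A]
    (φ : A →ₐ[K] K) : ∃ e : A, (∀ a, a * e = φ a • e) ∧ φ e = 1 := by
  obtain ⟨J, hJ⟩ := exists_isCompl (RingHom.ker φ : Submodule A A)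
  obtain ⟨i, hi, e, he, hie⟩ := Submodule.mem_sup.1
    (hJ.sup_eq_top ▸ Submodule.mem_top : (1 : A) ∈ (RingHom.ker φ : Submodule A A) ⊔ J)
  have hφ : φ e = 1 := by
    have h := congrArg φ hie
    rwa [map_add, map_one, (RingHom.mem_ker (f := φ)).1 hi, zero_add] at h
  refine ⟨e, fun a => ?_, hφ⟩
  rw [← sub_eq_zero]
  refine (Submodule.disjoint_def.1 hJ.disjoint) _ ?_ ?_
  · change φ _ = 0
    simp [hφ]
  · refine J.sub_mem (J.smul_mem a he) ?_
    rw [Algebra.smul_def]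
    exact J.smul_mem _ he

/-- A semisimple augmented algebra has a normalized two-sided integral. -/
lemma exists_integral {K A : Type} [Field K] [Ring A] [Algebra K A] [IsSemisimpleRing A]
    (φ : A →ₐ[K] K) :
    ∃ e : A, (∀ a, a * e = φ a • e) ∧ (∀ a, e * a = φ a • e) ∧ φ e = 1 := by
  obtain ⟨e, he, he1⟩ := exists_left_integral φ
  obtain ⟨e', he', he1'⟩ := exists_left_integral (φ.fromOpposite fun _ _ => Commute.all _ _)
  have hr (a : A) : e'.unop * a = φ a • e'.unop :=
    congrArg MulOpposite.unop (he' (MulOpposite.op a))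
  have heq : e = e'.unop := by
    have h1 := he e'.unop
    have h2 := hr e
    have h3 : φ e'.unop = 1 := he1'
    rw [h3, one_smul] at h1
    rw [he1, one_smul] at h2
    exact h1.symm.trans h2
  exact ⟨e, he, heq ▸ hr, he1⟩

variable {K : Type} [Field K] {H : Type} [Ring H] [HopfAlgebra K H]

/-- A grouplike element lying in a sum of two subcoalgebras lies in one of them. -/
lemma one_mem_of_mem_sup {D E : Submodule K H} (hD : IsSubcoalgebra K H D)
    (hE : IsSubcoalgebra K H E) (h : (1 : H) ∈ D ⊔ E) : (1 : H) ∈ D ∨ (1 : H) ∈ E := by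
  by_contra! hcon
  obtain ⟨d, hd, e, he, hde⟩ := Submodule.mem_sup.1 h
  obtain ⟨f, hf1, hfE⟩ := Submodule.exists_dual_map_eq_bot_of_notMem hcon.2 inferInstance
  have hf (x : H) (hx : x ∈ E) : f x = 0 := by
    have : f x ∈ E.map f := Submodule.mem_map_of_mem hx
    rwa [hfE, Submodule.mem_bot] at this
  let F : H ⊗[K] H →ₗ[K] H := (TensorProduct.lid K H).toLinearMap ∘ₗ f.rTensor H
  have hFd : F (comul d) ∈ D := by
    have hle : Submodule.map₂ (TensorProduct.mk K H H) D D ≤ D.comap F := by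
      rw [Submodule.map₂_le]
      intro m _ n hn
      simpa [F] using D.smul_mem (f m) hn
    exact hle (hD d hd)
  have hFe : F (comul e) = 0 := by
    have hle : Submodule.map₂ (TensorProduct.mk K H H) E E ≤ LinearMap.ker F := by
      rw [Submodule.map₂_le]
      intro m hm n _
      simp [F, hf m hm]
    exact hle (hE e he)
  have h1 : F (comul (1 : H)) = f 1 • 1 := by
    simp [F, Algebra.TensorProduct.one_def]
  rw [← hde, map_add, map_add, hFe, add_zero, hde] at h1
  rw [h1] at hFd
  exact hcon.1 ((D.smul_mem_iff hf1).1 hFd)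

lemma isSubcoalgebra_sSup {S : Set (Submodule K H)} (hS : ∀ D ∈ S, IsSubcoalgebra K H D) :
    IsSubcoalgebra K H (sSup S) := by
  have : sSup S ≤ (Submodule.map₂ (TensorProduct.mk K H H) (sSup S) (sSup S)).comap comul :=
    sSup_le fun D hD a ha =>
      Submodule.map₂_le_map₂ (le_sSup hD) (le_sSup hD) (hS D hD a ha)
  exact this

lemma exists_one_mem_of_mem_sSup {S : Set (Submodule K H)}
    (hS : ∀ D ∈ S, IsSubcoalgebra K H D) (h : (1 : H) ∈ sSup S) : ∃ D ∈ S, (1 : H) ∈ D := by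
  classical
  obtain ⟨s, hs, h1⟩ := Submodule.mem_sSup_iff_exists_finset.1 h
  induction s using Finset.induction_on with
  | empty =>
    have h0 : (1 : H) = 0 := by simpa using h1
    simpa using congrArg (counit (R := K)) h0
  | insert D s _ ih =>
    rw [Finset.coe_insert, Set.insert_subset_iff] at hs
    rw [Finset.iSup_insert] at h1
    have hsub : IsSubcoalgebra K H (⨆ i ∈ s, i) := by
      have := isSubcoalgebra_sSup (S := (s : Set (Submodule K H))) fun D hD => hS D (hs.2 hD)
      rwa [sSup_eq_iSup] at this
    rcases one_mem_of_mem_sup (hS D hs.1) hsub h1 with h | h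
    · exact ⟨D, hs.1, h⟩
    · exact ih hs.2 h

/-- A cosemisimple Hopf algebra has a normalized right integral in its dual. -/
lemma exists_cointegral (hcoss : IsCosemisimpleCoalgebra K H) :
    ∃ l : H →ₗ[K] K, l 1 = 1 ∧
      ∀ h, TensorProduct.lid K H (l.rTensor H (comul h)) = l h • 1 := by
  let L : Submodule K H := K ∙ 1
  let S : Set (Submodule K H) := {D | IsSimpleSubcoalgebra K H D ∧ D ≠ L}
  have hL : IsSubcoalgebra K H L := by
    intro a ha
    obtain ⟨c, rfl⟩ := Submodule.mem_span_singleton.1 ha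
    rw [map_smul, Bialgebra.comul_one, Algebra.TensorProduct.one_def]
    exact Submodule.smul_mem _ _ (Submodule.apply_mem_map₂ _
      (Submodule.mem_span_singleton_self 1) (Submodule.mem_span_singleton_self 1))
  have h10 : (1 : H) ≠ 0 := fun h0 => by simpa using congrArg (counit (R := K)) h0
  have h1 : (1 : H) ∉ sSup S := by
    intro h
    obtain ⟨D, hD, h1D⟩ := exists_one_mem_of_mem_sSup (fun D hD => hD.1.2.1) h
    have hLD : L ≤ D := (Submodule.span_singleton_le_iff_mem _ _).2 h1D
    rcases hD.1.2.2 L hLD hL with h | h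
    · exact h10 (by simpa [L] using h)
    · exact hD.2 h.symm
  have htop : L ⊔ sSup S = ⊤ := by
    rw [eq_top_iff, ← hcoss]
    refine sSup_le fun D hD => ?_
    by_cases hDL : D = L
    · exact hDL ▸ le_sup_left
    · exact le_sup_of_le_right (le_sSup ⟨hD, hDL⟩)
  obtain ⟨f, hf1, hfS⟩ := Submodule.exists_dual_map_eq_bot_of_notMem h1 inferInstance
  have hf (x : H) (hx : x ∈ sSup S) : f x = 0 := by
    have : f x ∈ (sSup S).map f := Submodule.mem_map_of_mem hx
    rwa [hfS, Submodule.mem_bot] at this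
  have hS : IsSubcoalgebra K H (sSup S) := isSubcoalgebra_sSup fun D hD => hD.1.2.1
  have hker : sSup S ≤ LinearMap.ker ((TensorProduct.lid K H).toLinearMap ∘ₗ f.rTensor H ∘ₗ comul) := by
    intro a ha
    have hle : Submodule.map₂ (TensorProduct.mk K H H) (sSup S) (sSup S) ≤
        LinearMap.ker ((TensorProduct.lid K H).toLinearMap ∘ₗ f.rTensor H) := by
      rw [Submodule.map₂_le]
      intro m hm n _
      simp [hf m hm]
    exact hle (hS a ha)
  refine ⟨(f 1)⁻¹ • f, by simp [hf1], fun h => ?_⟩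
  obtain ⟨a, ha, b, hb, rfl⟩ := Submodule.mem_sup.1 (htop ▸ Submodule.mem_top : h ∈ L ⊔ sSup S)
  obtain ⟨c, rfl⟩ := Submodule.mem_span_singleton.1 ha
  have hb' : TensorProduct.lid K H (f.rTensor H (comul b)) = 0 := hker hb
  simp [hb', hf b hb, Algebra.TensorProduct.one_def, LinearMap.rTensor_smul, hf1, smul_smul, mul_comm]

/-- The integral formula `Σ λ(g₍₁₎ h) g₍₂₎ = Σ λ(g h₍₁₎) S(h₍₂₎)`. -/
lemma cointegral_exchange {l : H →ₗ[K] K}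
    (hl : ∀ h, TensorProduct.lid K H (l.rTensor H (comul h)) = l h • 1) (g h : H)
    {ι κ : Type*} (𝓖 : Repr K g ι) (𝓗 : Repr K h κ) :
    ∑ i ∈ 𝓖.index, l (𝓖.left i * h) • 𝓖.right i =
      ∑ j ∈ 𝓗.index, l (g * 𝓗.left j) • HopfAlgebra.antipode K (𝓗.right j) := by
  let F : H ⊗[K] H →ₗ[K] H := (TensorProduct.lid K H).toLinearMap ∘ₗ l.rTensor H ∘ₗ
    LinearMap.mul K (H ⊗[K] H) (comul g)
  have hF (x y : H) : F (x ⊗ₜ y) = ∑ i ∈ 𝓖.index, l (𝓖.left i * x) • (𝓖.right i * y) := by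
    simp [F, ← 𝓖.eq]
  have hFΔ (x : H) : F (comul x) = l (g * x) • 1 := by
    rw [← hl]
    simp [F]
  let Φ : H ⊗[K] (H ⊗[K] H) →ₗ[K] H := LinearMap.mul' K H ∘ₗ
    TensorProduct.map F (HopfAlgebra.antipode K) ∘ₗ (TensorProduct.assoc K H H H).symm.toLinearMap
  have hco := congrArg Φ (coassoc_apply (R := K) h)
  have hleft : Φ (TensorProduct.assoc K H H H (comul.rTensor H (comul (R := K) h))) =
      ∑ j ∈ 𝓗.index, l (g * 𝓗.left j) • HopfAlgebra.antipode K (𝓗.right j) := by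
    simp [Φ, ← 𝓗.eq, hFΔ]
  have hright : Φ (comul.lTensor H (comul (R := K) h)) = F (h ⊗ₜ 1) := by
    have hx (x y : H) : Φ (x ⊗ₜ comul y) = counit (R := K) y • F (x ⊗ₜ 1) := by
      conv_lhs => rw [← (ℛ K y).eq]
      simp only [Φ, TensorProduct.tmul_sum, map_sum, LinearMap.comp_apply, LinearEquiv.coe_coe,
        TensorProduct.assoc_symm_tmul, TensorProduct.map_tmul, LinearMap.mul'_apply, hF]
      simp only [Finset.sum_mul, smul_mul_assoc, mul_assoc]
      rw [Finset.sum_comm]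
      simp only [← Finset.smul_sum, ← Finset.mul_sum,
        HopfAlgebra.sum_mul_antipode_eq_smul (ℛ K y), mul_smul_comm]
      rw [Finset.smul_sum]
      exact Finset.sum_congr rfl fun _ _ => smul_comm _ _ _
    have hΦ : Φ ∘ₗ comul.lTensor H = F ∘ₗ (TensorProduct.mk K H H).flip 1 ∘ₗ
        (TensorProduct.rid K H).toLinearMap ∘ₗ (counit (R := K)).lTensor H := by
      ext x y
      simp [hx]
    have := LinearMap.congr_fun hΦ (comul (R := K) h)
    simpa using this
  rw [← hleft, hco, hright, hF]
  simp

/-- A semisimple and cosemisimple Hopf algebra has a normalized left integral in its dual which is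
invariant under the adjoint action. -/
lemma exists_invariant_cointegral [FiniteDimensional K H] (hss : IsSemisimpleRing H)
    (hcoss : IsCosemisimpleCoalgebra K H) :
    ∃ m : H →ₗ[K] K, m 1 = 1 ∧
      (∀ h, TensorProduct.rid K H (m.lTensor H (comul h)) = m h • 1) ∧
      ∀ h a, m (adEnd K H h a) = counit (R := K) h * m a := by
  obtain ⟨e, hel, her, he1⟩ := exists_integral (Bialgebra.counitAlgHom K H)
  obtain ⟨l, hl1, hl⟩ := exists_cointegral hcoss
  simp only [Bialgebra.counitAlgHom_apply] at hel her he1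
  let S : H →ₗ[K] H := HopfAlgebra.antipode K
  have hS₁ (h : H) : l e • S h = ∑ i ∈ (ℛ K e).index, l ((ℛ K e).left i * h) • (ℛ K e).right i := by
    rw [cointegral_exchange hl e h (ℛ K e) (ℛ K h)]
    conv_lhs => rw [← Coalgebra.sum_counit_smul (ℛ K h)]
    simp [her, S, smul_smul, mul_comm, Finset.smul_sum]
  have hS₂ (g : H) : l e • g = S (∑ i ∈ (ℛ K e).index,
      l (g * (ℛ K e).left i) • (ℛ K e).right i) := by
    have := cointegral_exchange hl g e (ℛ K g) (ℛ K e)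
    simp only [map_sum, map_smul, S]
    rw [← this]
    conv_lhs => rw [← Coalgebra.sum_counit_smul (ℛ K g)]
    simp [hel, smul_smul, mul_comm, Finset.smul_sum]
  have htr (x : H) : l e * LinearMap.trace K H (leftMul K H x ∘ₗ S ∘ₗ S) = l (S x) := by
    have hop : l e • (leftMul K H x ∘ₗ S ∘ₗ S) = ∑ i ∈ (ℛ K e).index,
        (l ∘ₗ leftMul K H ((ℛ K e).left i) ∘ₗ S).smulRight (x * (ℛ K e).right i) := by
      ext b
      have := congrArg (x * ·) (hS₁ (S b))
      simpa [Finset.mul_sum] using this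
    rw [← smul_eq_mul, ← map_smul, hop, map_sum]
    simp only [LinearMap.trace_smulRight, LinearMap.comp_apply, leftMul_apply, S,
      HopfAlgebra.antipode_mul_antidistrib, ← mul_assoc]
    rw [← map_sum, ← Finset.sum_mul, HopfAlgebra.sum_mul_antipode_eq_smul (ℛ K e), he1]
    simp
  have hc : l e ≠ 0 := by
    intro h0
    have := htr 1
    simp [h0, S, hl1] at this
  have hSinj : Function.Injective S := by
    refine LinearMap.injective_iff_surjective.2 fun g => ?_
    refine ⟨(l e)⁻¹ • ∑ i ∈ (ℛ K e).index, l (g * (ℛ K e).left i) • (ℛ K e).right i, ?_⟩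
    rw [map_smul, ← hS₂, smul_smul, inv_mul_cancel₀ hc, one_smul]
  refine ⟨l ∘ₗ S, by simp [S, hl1], fun h => hSinj ?_, fun h a => ?_⟩
  · have := hl (S h)
    rw [comul_antipode, ← (ℛ K h).eq] at this
    rw [← (ℛ K h).eq]
    simpa [S] using this
  · have hadj (a : H) : leftMul K H (adEnd K H h a) ∘ₗ S ∘ₗ S = ∑ i ∈ (ℛ K h).index,
        leftMul K H ((ℛ K h).left i) *
          (leftMul K H (a * S ((ℛ K h).right i)) ∘ₗ S ∘ₗ S) := by
      ext b
      simp [adEnd_apply (ℛ K h), S, mul_assoc]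
    have hcyc : ∑ i ∈ (ℛ K h).index, (leftMul K H (a * S ((ℛ K h).right i)) ∘ₗ S ∘ₗ S) *
        leftMul K H ((ℛ K h).left i) = counit (R := K) h • (leftMul K H a ∘ₗ S ∘ₗ S) := by
      ext b
      have h1 := congrArg S (HopfAlgebra.sum_antipode_mul_eq_smul (ℛ K h))
      simp only [S, map_sum, HopfAlgebra.antipode_mul_antidistrib, map_smul,
        HopfAlgebra.antipode_one] at h1
      have h2 := congrArg (fun y => a * y * S (S b)) h1
      simpa [S, HopfAlgebra.antipode_mul_antidistrib, Finset.mul_sum, Finset.sum_mul,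
        mul_assoc] using h2
    simp only [LinearMap.comp_apply]
    rw [← htr, ← htr, hadj, map_sum]
    simp only [LinearMap.trace_mul_comm K (leftMul K H _)]
    rw [← map_sum, hcyc, map_smul, smul_eq_mul]
    ring

end Integrals

section Projection

open Coalgebra

variable {K : Type} [Field K] {H : Type} [Ring H] [HopfAlgebra K H]

lemma map_mem_of_mem_map₂_top {V : Type} [AddCommGroup V] [Module K V] {D : Submodule K H}
    {N : Submodule K V} {z : H ⊗[K] H} (hz : z ∈ Submodule.map₂ (TensorProduct.mk K H H) ⊤ D)
    (f : H ⊗[K] H →ₗ[K] V) (hf : ∀ a, ∀ d ∈ D, f (a ⊗ₜ d) ∈ N) : f z ∈ N := by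
  have : Submodule.map₂ (TensorProduct.mk K H H) ⊤ D ≤ N.comap f :=
    Submodule.map₂_le.2 fun a _ d hd => hf a d hd
  exact this hz

lemma lTensor_mem_map₂_top {D : Submodule K H} {f : H →ₗ[K] H} (hf : ∀ x, f x ∈ D)
    (z : H ⊗[K] H) : f.lTensor H z ∈ Submodule.map₂ (TensorProduct.mk K H H) ⊤ D := by
  induction z with
  | zero => simp
  | add z w hz hw => rw [map_add]; exact add_mem hz hw
  | tmul a b => exact Submodule.apply_mem_map₂ _ trivial (hf b)

lemma lTensor_congr_of_mem_map₂_top {V : Type} [AddCommGroup V] [Module K V] {D : Submodule K H}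
    {f g : H →ₗ[K] V} (hfg : ∀ x ∈ D, f x = g x) {z : H ⊗[K] H}
    (hz : z ∈ Submodule.map₂ (TensorProduct.mk K H H) ⊤ D) :
    f.lTensor H z = g.lTensor H z := by
  have := map_mem_of_mem_map₂_top (N := ⊥) hz (f.lTensor H - g.lTensor H) fun a d hd => by
    simp [hfg d hd]
  simpa [sub_eq_zero] using this

/-- Over a semisimple algebra, an invariant subspace is the range of an equivariant projection. -/
lemma exists_equivariant_projection {A V : Type} [Ring A] [Algebra K A] [IsSemisimpleRing A]
    [AddCommGroup V] [Module K V] (ρ : A →ₐ[K] Module.End K V) (D : Submodule K V)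
    (hD : ∀ a, ∀ x ∈ D, ρ a x ∈ D) :
    ∃ p : V →ₗ[K] V, (∀ x, p x ∈ D) ∧ (∀ x ∈ D, p x = x) ∧ ∀ a x, p (ρ a x) = ρ a (p x) := by
  let _ : Module A V := Module.compHom V ρ.toRingHom
  have hsmul (a : A) (x : V) : a • x = ρ a x := rfl
  have : IsScalarTower K A V := ⟨fun c a x => by simp [hsmul]⟩
  let D' : Submodule A V := { D.toAddSubmonoid with smul_mem' := fun a x hx => hD a x hx }
  obtain ⟨f, hf⟩ := IsSemisimpleModule.extension_property D'.subtype D'.subtype_injective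
    (LinearMap.id (R := A) (M := D'))
  refine ⟨(D'.subtype ∘ₗ f).restrictScalars K, fun x => (f x).2, fun x hx => ?_, fun a x => ?_⟩
  · exact congrArg Subtype.val (LinearMap.congr_fun hf (⟨x, hx⟩ : D'))
  · exact map_smul (D'.subtype ∘ₗ f) a x

/-- The adjoint action as an algebra homomorphism. -/
noncomputable def adHom (K H : Type) [Field K] [Ring H] [HopfAlgebra K H] :
    H →ₐ[K] Module.End K H :=
  AlgHom.ofLinearMap (adEnd K H) adEnd_one adEnd_mul

@[simp] lemma adHom_apply (h : H) : adHom K H h = adEnd K H h := rfl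

/-- The map `a ⊗ b ↦ a * S(b)`. -/
noncomputable def mulAntipode (K H : Type) [Field K] [Ring H] [HopfAlgebra K H] :
    H ⊗[K] H →ₗ[K] H :=
  LinearMap.mul' K H ∘ₗ (HopfAlgebra.antipode K).lTensor H

@[simp] lemma mulAntipode_tmul (a b : H) :
    mulAntipode K H (a ⊗ₜ b) = a * HopfAlgebra.antipode K b := by
  simp [mulAntipode]

lemma intertwines_onFst_onFst_lTensor (p : Module.End K H) (f : H →ₗ[K] Module.End K H) :
    Intertwines (p.lTensor H) ((onFst K H).toLinearMap ∘ₗ f) ((onFst K H).toLinearMap ∘ₗ f) := by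
  intro h z
  induction z with
  | zero => simp
  | add z w hz hw => simp only [map_add, hz, hw]
  | tmul a b => simp

lemma Intertwines.lTensor {p : Module.End K H} {f : H →ₗ[K] Module.End K H}
    (hp : Intertwines p f f) :
    Intertwines (p.lTensor H) ((onSnd K H).toLinearMap ∘ₗ f) ((onSnd K H).toLinearMap ∘ₗ f) := by
  intro h z
  induction z with
  | zero => simp
  | add z w hz hw => simp only [map_add, hz, hw]
  | tmul a b => simp [hp h b]

lemma Intertwines.lTensor_adEndTensor {p : Module.End K H}
    (hp : Intertwines p (adEnd K H) (adEnd K H)) :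
    Intertwines (p.lTensor H) (adEndTensor K H) (adEndTensor K H) :=
  (intertwines_onFst_onFst_lTensor p _).conv
    (hp.lTensor.conv (intertwines_onFst_onFst_lTensor p _))

lemma intertwines_mulAntipode :
    Intertwines (mulAntipode K H) (adEndTensor K H) (adEnd K H) := by
  have hE : adEndTensor K H = conv ((onFst K H).toLinearMap ∘ₗ leftMul K H)
      (conv ((onSnd K H).toLinearMap ∘ₗ leftMul K H)
        (conv ((onSnd K H).toLinearMap ∘ₗ rightMulAntipode K H)
          ((onFst K H).toLinearMap ∘ₗ rightMulAntipode K H))) := by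
    rw [adEndTensor, adEnd, comp_conv]
    simp only [conv_assoc]
  have hA : adEnd K H = conv (leftMul K H)
      (conv (rightMulAntipode K H) (convUnit K H (Module.End K H))) := by
    rw [conv_convUnit, adEnd]
  rw [hE, hA]
  refine .conv ?_ (.conv ?_ ?_) <;> intro h z <;> induction z with
  | zero => simp
  | add z w hz hw => simp only [map_add, hz, hw]
  | tmul a b => ?_
  · simp [mul_assoc]
  · simp [HopfAlgebra.antipode_mul_antidistrib, mul_assoc]
  · have h1 := congrArg (HopfAlgebra.antipode K) (HopfAlgebra.sum_antipode_mul_eq_smul (ℛ K h))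
    simp only [map_sum, HopfAlgebra.antipode_mul_antidistrib, map_smul,
      HopfAlgebra.antipode_one] at h1
    have h2 := congrArg (fun y => a * y * HopfAlgebra.antipode K b) h1
    simpa [conv_apply (ℛ K h), convUnit_apply, HopfAlgebra.antipode_mul_antidistrib,
      Finset.mul_sum, Finset.sum_mul, mul_assoc, Algebra.algebraMap_eq_smul_one] using h2

/-- The operator `x ↦ Σ x₍₁₎ e(x₍₂₎)`. -/
noncomputable def dualAct (e : H →ₗ[K] K) : Module.End K H :=
  (TensorProduct.rid K H).toLinearMap ∘ₗ e.lTensor H ∘ₗ comul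

lemma dualAct_apply {ι : Type*} {x : H} (𝓡 : Repr K x ι) (e : H →ₗ[K] K) :
    dualAct e x = ∑ i ∈ 𝓡.index, e (𝓡.right i) • 𝓡.left i := by
  simp [dualAct, ← 𝓡.eq]

lemma rid_lTensor_mul_tmul_one (m : H →ₗ[K] K) (z : H ⊗[K] H) (w : H) :
    TensorProduct.rid K H (m.lTensor H (z * w ⊗ₜ 1)) =
      TensorProduct.rid K H (m.lTensor H z) * w := by
  induction z with
  | zero => simp
  | add z w hz hw => simp only [add_mul, map_add, hz, hw]
  | tmul a b => simp

/-- The exchange identity `Σ x₍₁₎ m(x₍₂₎ S(w)) = Σ m(x S(w₍₁₎)) w₍₂₎` for a left integral `m` on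
`H`. -/
lemma rid_lTensor_comul_mul_antipode {m : H →ₗ[K] K}
    (hm : ∀ h, TensorProduct.rid K H (m.lTensor H (comul h)) = m h • 1) (x w : H) :
    TensorProduct.rid K H (m.lTensor H (comul x * 1 ⊗ₜ HopfAlgebra.antipode K w)) =
      TensorProduct.lid K H
        ((m ∘ₗ leftMul K H x ∘ₗ HopfAlgebra.antipode K).rTensor H (comul w)) := by
  have key : conv (comul (R := K) (A := H) ∘ₗ HopfAlgebra.antipode K)
      (Algebra.TensorProduct.includeLeft (R := K) (S := K) (A := H) (B := H)).toLinearMap =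
      Algebra.TensorProduct.includeRight.toLinearMap ∘ₗ HopfAlgebra.antipode K := by
    rw [comul_comp_antipode, conv_assoc, antipode_conv_algHom, conv_convUnit]
  have := LinearMap.congr_fun key w
  rw [conv_apply (ℛ K w)] at this
  simp only [LinearMap.comp_apply, AlgHom.toLinearMap_apply,
    Algebra.TensorProduct.includeLeft_apply, Algebra.TensorProduct.includeRight_apply] at this
  rw [← this, ← (ℛ K w).eq]
  simp [Finset.mul_sum, ← mul_assoc, ← Bialgebra.comul_mul, rid_lTensor_mul_tmul_one, hm]

/-- Every Yetter-Drinfeld submodule is the image of a projection given by an invariant functional. -/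
lemma exists_invariant_functional [FiniteDimensional K H] (hss : IsSemisimpleRing H)
    (hcoss : IsCosemisimpleCoalgebra K H) {D : Submodule K H} (hD : IsYDSubmodule K H D) :
    ∃ e : H →ₗ[K] K, (∀ h x, e (adEnd K H h x) = counit (R := K) h * e x) ∧
      (∀ x, dualAct e x ∈ D) ∧ ∀ x ∈ D, dualAct e x = x := by
  obtain ⟨m, hm1, hm, hmad⟩ := exists_invariant_cointegral hss hcoss
  obtain ⟨p, hpD, hp, hpad⟩ := exists_equivariant_projection (adHom K H) D
    fun a x hx => by simpa [adAct_eq] using hD.1 a x hx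
  have hpI : Intertwines p (adEnd K H) (adEnd K H) := hpad
  have hI := (intertwines_mulAntipode.comp hpI.lTensor_adEndTensor).comp
    (intertwines_comul (K := K) (H := H))
  refine ⟨m ∘ₗ (mulAntipode K H ∘ₗ p.lTensor H) ∘ₗ comul, fun h x => ?_, fun x => ?_,
    fun x hx => ?_⟩
  · rw [LinearMap.comp_apply, hI h x, hmad]
    rfl
  · have h1 (z : H ⊗[K] H) (r : H) : TensorProduct.rid K H
        ((m ∘ₗ mulAntipode K H ∘ₗ p.lTensor H).lTensor H (TensorProduct.assoc K H H H (z ⊗ₜ r))) =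
        TensorProduct.rid K H (m.lTensor H (z * 1 ⊗ₜ HopfAlgebra.antipode K (p r))) := by
      induction z with
      | zero => simp
      | add z w hz hw => simp only [TensorProduct.add_tmul, add_mul, map_add, hz, hw]
      | tmul a b => simp
    have h2 : dualAct (m ∘ₗ (mulAntipode K H ∘ₗ p.lTensor H) ∘ₗ comul) x =
        ∑ i ∈ (ℛ K x).index, TensorProduct.lid K H
          ((m ∘ₗ leftMul K H ((ℛ K x).left i) ∘ₗ HopfAlgebra.antipode K).rTensor H
            (comul (p ((ℛ K x).right i)))) := by
      simp only [← rid_lTensor_comul_mul_antipode hm, ← h1, ← map_sum]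
      have h3 : (m ∘ₗ (mulAntipode K H ∘ₗ p.lTensor H) ∘ₗ comul).lTensor H (comul x) =
          (m ∘ₗ mulAntipode K H ∘ₗ p.lTensor H).lTensor H (comul.lTensor H (comul x)) :=
        LinearMap.lTensor_comp_apply H (m ∘ₗ mulAntipode K H ∘ₗ p.lTensor H) comul _
      rw [dualAct, LinearMap.comp_apply, LinearMap.comp_apply, LinearEquiv.coe_coe, h3,
        ← coassoc_apply]
      conv_lhs => rw [← (ℛ K x).eq, map_sum]
      simp only [LinearMap.rTensor_tmul]
    rw [h2]
    refine sum_mem fun i _ => ?_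
    refine map_mem_of_mem_map₂_top (hD.2 _ (hpD ((ℛ K x).right i)))
      ((TensorProduct.lid K H).toLinearMap ∘ₗ
        (m ∘ₗ leftMul K H ((ℛ K x).left i) ∘ₗ HopfAlgebra.antipode K).rTensor H) fun a d hd => ?_
    simpa using D.smul_mem _ hd
  · have h1 : ∀ y ∈ D, (m ∘ₗ (mulAntipode K H ∘ₗ p.lTensor H) ∘ₗ comul) y =
        counit (R := K) y := by
      intro y hy
      have h2 := lTensor_congr_of_mem_map₂_top (f := p) (g := LinearMap.id) hp (hD.2 y hy)
      simp only [LinearMap.comp_apply, h2, LinearMap.lTensor_id, LinearMap.id_apply]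
      rw [mulAntipode, LinearMap.comp_apply, HopfAlgebra.mul_antipode_lTensor_comul_apply]
      simp [Algebra.algebraMap_eq_smul_one, hm1]
    rw [dualAct, LinearMap.comp_apply, LinearMap.comp_apply,
      lTensor_congr_of_mem_map₂_top h1 (hD.2 x hx)]
    simp

end Projection

section QuasiTriangular

open Coalgebra

variable {K : Type} [Field K] {H : Type} [Ring H] [HopfAlgebra K H]
variable {R : H ⊗[K] H} {s : Finset (H × H)}

lemma IsQuasiTriangular.sum_comul_tmul (hR : IsQuasiTriangular K H R)
    (hs : R = ∑ j ∈ s, j.1 ⊗ₜ j.2) :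
    ∑ j ∈ s, TensorProduct.assoc K H H H (comul j.1 ⊗ₜ j.2) =
      ∑ j ∈ s, ∑ k ∈ s, j.1 ⊗ₜ[K] (k.1 ⊗ₜ[K] (j.2 * k.2)) := by
  have := hR.comul_rTensor
  rw [hs] at this
  simpa [r13, r23, Finset.sum_mul_sum, TensorProduct.tmul_sum] using this

lemma IsQuasiTriangular.sum_tmul_comul (hR : IsQuasiTriangular K H R)
    (hs : R = ∑ j ∈ s, j.1 ⊗ₜ j.2) :
    ∑ j ∈ s, j.1 ⊗ₜ[K] comul (R := K) j.2 =
      ∑ j ∈ s, ∑ k ∈ s, (j.1 * k.1) ⊗ₜ[K] (k.2 ⊗ₜ[K] j.2) := by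
  have := hR.comul_lTensor
  rw [hs] at this
  simpa [r13, r12, Finset.sum_mul_sum] using this

lemma IsQuasiTriangular.sum_counit_smul (hR : IsQuasiTriangular K H R)
    (hs : R = ∑ j ∈ s, j.1 ⊗ₜ j.2) : ∑ j ∈ s, counit (R := K) j.1 • j.2 = 1 := by
  have h1 := congrArg ((TensorProduct.lid K (H ⊗[K] H)).toLinearMap ∘ₗ
    (counit (R := K) (A := H)).rTensor (H ⊗[K] H)) (hR.sum_comul_tmul hs)
  have h2 (z : H ⊗[K] H) (y : H) : TensorProduct.lid K (H ⊗[K] H)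
      ((counit (R := K) (A := H)).rTensor (H ⊗[K] H) (TensorProduct.assoc K H H H (z ⊗ₜ y))) =
      TensorProduct.lid K H ((counit (R := K) (A := H)).rTensor H z) ⊗ₜ y := by
    induction z with
    | zero => simp
    | add z w hz hw => simp only [TensorProduct.add_tmul, map_add, hz, hw]
    | tmul a b => simp [TensorProduct.smul_tmul']
  have h3 : R = (1 ⊗ₜ[K] ∑ j ∈ s, counit (R := K) j.1 • j.2) * R := by
    simp only [map_sum, LinearMap.comp_apply, LinearEquiv.coe_coe, h2] at h1
    conv_rhs => rw [hs, TensorProduct.tmul_sum, Finset.sum_mul_sum]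
    simpa [← hs] using h1
  have h4 : (1 : H ⊗[K] H) = 1 ⊗ₜ[K] ∑ j ∈ s, counit (R := K) j.1 • j.2 :=
    hR.isUnit.mul_right_cancel (by rw [one_mul]; exact h3)
  have h5 := congrArg ((TensorProduct.lid K H).toLinearMap ∘ₗ
    (counit (R := K) (A := H)).rTensor H) h4
  simpa [Algebra.TensorProduct.one_def] using h5.symm

lemma IsQuasiTriangular.sum_smul_counit (hR : IsQuasiTriangular K H R)
    (hs : R = ∑ j ∈ s, j.1 ⊗ₜ j.2) : ∑ j ∈ s, counit (R := K) j.2 • j.1 = 1 := by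
  have h1 := congrArg (((TensorProduct.rid K H).toLinearMap ∘ₗ
    (counit (R := K) (A := H)).lTensor H).lTensor H) (hR.sum_tmul_comul hs)
  have h3 : R = ((∑ j ∈ s, counit (R := K) j.2 • j.1) ⊗ₜ[K] 1) * R := by
    conv_rhs => rw [hs, TensorProduct.sum_tmul, Finset.sum_mul_sum]
    simpa [← hs, TensorProduct.smul_tmul'] using h1
  have h4 : (1 : H ⊗[K] H) = (∑ j ∈ s, counit (R := K) j.2 • j.1) ⊗ₜ[K] 1 :=
    hR.isUnit.mul_right_cancel (by rw [one_mul]; exact h3)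
  have h5 := congrArg ((TensorProduct.rid K H).toLinearMap ∘ₗ
    (counit (R := K) (A := H)).lTensor H) h4
  simpa [Algebra.TensorProduct.one_def] using h5.symm

/-- The universal `R`-matrix is invariant under `S ⊗ S`. -/
lemma IsQuasiTriangular.map_antipode (hR : IsQuasiTriangular K H R) :
    TensorProduct.map (HopfAlgebra.antipode K) (HopfAlgebra.antipode K) R = R := by
  obtain ⟨s, hs⟩ := TensorProduct.exists_finset R
  let S : H →ₗ[K] H := HopfAlgebra.antipode K
  have h1 : S.rTensor H R * R = 1 := by
    have h := congrArg ((LinearMap.mul' K H ∘ₗ S.rTensor H).rTensor H ∘ₗ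
      (TensorProduct.assoc K H H H).symm.toLinearMap) (hR.sum_comul_tmul hs)
    simp only [map_sum, LinearMap.comp_apply, LinearEquiv.coe_coe, LinearEquiv.symm_apply_apply,
      LinearMap.rTensor_tmul, S, HopfAlgebra.mul_antipode_rTensor_comul_apply] at h
    rw [hs, map_sum, Finset.sum_mul_sum]
    simp only [LinearMap.rTensor_tmul, Algebra.TensorProduct.tmul_mul_tmul]
    refine Eq.trans ?_ (h.symm.trans ?_)
    · simp [S]
    · have := hR.sum_counit_smul hs
      simp only [Algebra.algebraMap_eq_smul_one, TensorProduct.smul_tmul, ← TensorProduct.tmul_sum,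
        this, Algebra.TensorProduct.one_def]
  have h2 : TensorProduct.map S S R * S.rTensor H R = 1 := by
    have h := congrArg (TensorProduct.map S (LinearMap.mul' K H ∘ₗ S.rTensor H))
      (hR.sum_tmul_comul hs)
    simp only [map_sum, LinearMap.comp_apply, TensorProduct.map_tmul, S,
      HopfAlgebra.mul_antipode_rTensor_comul_apply] at h
    rw [hs, map_sum, map_sum, Finset.sum_mul_sum, Finset.sum_comm]
    simp only [LinearMap.rTensor_tmul, TensorProduct.map_tmul,
      Algebra.TensorProduct.tmul_mul_tmul]
    refine Eq.trans ?_ (h.symm.trans ?_)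
    · simp [S, HopfAlgebra.antipode_mul_antidistrib]
    · have := congrArg (HopfAlgebra.antipode K) (hR.sum_smul_counit hs)
      simp only [map_sum, map_smul, HopfAlgebra.antipode_one] at this
      simp only [Algebra.algebraMap_eq_smul_one, ← TensorProduct.smul_tmul,
        ← TensorProduct.sum_tmul, this, Algebra.TensorProduct.one_def]
  calc TensorProduct.map S S R = TensorProduct.map S S R * (S.rTensor H R * R) := by
        rw [h1, mul_one]
    _ = R := by rw [← mul_assoc, h2, one_mul]

/-- Right multiplication by the antipode as an algebra homomorphism. -/
noncomputable def rightMulAntipodeHom (K H : Type) [Field K] [Ring H] [HopfAlgebra K H] :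
    H →ₐ[K] Module.End K H :=
  AlgHom.ofLinearMap (rightMulAntipode K H) (by ext; simp)
    (fun a b => by ext; simp [HopfAlgebra.antipode_mul_antidistrib, mul_assoc])

@[simp] lemma rightMulAntipodeHom_apply (h : H) :
    rightMulAntipodeHom K H h = rightMulAntipode K H h := rfl

lemma commute_onSnd_onFst (f g : Module.End K H) : Commute (onSnd K H f) (onFst K H g) := by
  ext
  simp

/-- The action `(a ⊗ b) · (u ⊗ v) = u S(b) ⊗ a ·_ad v` of the algebra `H ⊗ H`. -/
noncomputable def twistHom (K H : Type) [Field K] [Ring H] [HopfAlgebra K H] :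
    H ⊗[K] H →ₐ[K] Module.End K (H ⊗[K] H) :=
  Algebra.TensorProduct.lift ((onSnd K H).comp (adHom K H))
    ((onFst K H).comp (rightMulAntipodeHom K H)) (fun _ _ => commute_onSnd_onFst _ _)

lemma twistHom_tmul (a b u v : H) :
    twistHom K H (a ⊗ₜ b) (u ⊗ₜ v) = (u * HopfAlgebra.antipode K b) ⊗ₜ adEnd K H a v := by
  have : twistHom K H (a ⊗ₜ b) = onSnd K H (adEnd K H a) * onFst K H (rightMulAntipode K H b) :=
    Algebra.TensorProduct.lift_tmul _ _ _ _ _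
  simp [this]

lemma deltaR_eq_twistHom (h : H) : deltaR K H R h = twistHom K H R (comul h) := by
  simp only [deltaR, LinearMap.comp_apply, LinearEquiv.coe_coe]
  generalize comul (R := K) h = z
  induction z with
  | zero => simp
  | add z w hz hw => simp only [map_add, hz, hw]
  | tmul u v =>
    induction R with
    | zero => simp
    | add z w hz hw =>
      simp only [map_add, LinearMap.add_apply] at hz hw ⊢
      rw [hz, hw]
    | tmul a b => simp [twistHom_tmul, adMap_tmul]

lemma twistHom_mem_map₂_top {D : Submodule K H} (hD : ∀ h, ∀ a ∈ D, adEnd K H h a ∈ D)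
    (Q : H ⊗[K] H) {z : H ⊗[K] H} (hz : z ∈ Submodule.map₂ (TensorProduct.mk K H H) ⊤ D) :
    twistHom K H Q z ∈ Submodule.map₂ (TensorProduct.mk K H H) ⊤ D := by
  refine map_mem_of_mem_map₂_top hz _ fun u v hv => ?_
  induction Q with
  | zero => simp
  | add z w hz hw => simpa using add_mem hz hw
  | tmul a b =>
    rw [twistHom_tmul]
    exact Submodule.apply_mem_map₂ _ trivial (hD a v hv)

lemma comul_eq_twistHom (hR : IsQuasiTriangular K H R) (h : H) :
    comul h = twistHom K H (hR.isUnit.unit⁻¹ : (H ⊗[K] H)ˣ) (deltaR K H R h) := by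
  rw [deltaR_eq_twistHom, ← Module.End.mul_apply, ← map_mul, IsUnit.val_inv_mul, map_one,
    Module.End.one_apply]

lemma rid_lTensor_deltaR (hR : IsQuasiTriangular K H R) {e : H →ₗ[K] K}
    (he : ∀ h x, e (adEnd K H h x) = counit (R := K) h * e x) (x : H) :
    TensorProduct.rid K H (e.lTensor H (deltaR K H R x)) = dualAct e x := by
  obtain ⟨s, hs⟩ := TensorProduct.exists_finset R
  rw [deltaR_eq_twistHom, dualAct, LinearMap.comp_apply, LinearMap.comp_apply,
    LinearEquiv.coe_coe]
  have h1 := congrArg (HopfAlgebra.antipode K) (hR.sum_counit_smul hs)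
  simp only [map_sum, map_smul, HopfAlgebra.antipode_one] at h1
  generalize comul (R := K) x = z
  induction z with
  | zero => simp
  | add z w hz hw => simp only [map_add, hz, hw]
  | tmul u v =>
    have h2 := congrArg (fun y => e v • (u * y)) h1
    simpa [hs, twistHom_tmul, he, Finset.mul_sum, Finset.smul_sum, smul_smul, mul_comm] using h2

lemma twistHom_apply_tmul (hR : IsQuasiTriangular K H R) (hs : R = ∑ j ∈ s, j.1 ⊗ₜ j.2)
    (u v : H) : twistHom K H R (u ⊗ₜ v) = ∑ j ∈ s,
      1 ⊗ₜ j.1 * (u ⊗ₜ v * TensorProduct.comm K H H R) * HopfAlgebra.antipode K j.2 ⊗ₜ 1 := by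
  have hv (a : H) : mulAntipode K H (((LinearMap.mul K H).flip v).rTensor H (comul a)) =
      adEnd K H a v := by
    rw [adEnd_apply (ℛ K a), ← (ℛ K a).eq]
    simp
  have h := congrArg ((TensorProduct.comm K H H).toLinearMap ∘ₗ
    TensorProduct.map (mulAntipode K H ∘ₗ ((LinearMap.mul K H).flip v).rTensor H)
      (leftMul K H u ∘ₗ HopfAlgebra.antipode K) ∘ₗ
    (TensorProduct.assoc K H H H).symm.toLinearMap) (hR.sum_comul_tmul hs)
  simp only [map_sum, LinearMap.comp_apply, LinearEquiv.coe_coe, LinearEquiv.symm_apply_apply,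
    TensorProduct.map_tmul, hv, TensorProduct.comm_tmul, TensorProduct.assoc_symm_tmul,
    LinearMap.rTensor_tmul, mulAntipode_tmul, leftMul_apply, LinearMap.flip_apply,
    LinearMap.mul_apply'] at h
  conv_rhs => rw [← hR.map_antipode]
  rw [hs]
  simp only [map_sum, LinearMap.sum_apply, twistHom_tmul, h]
  simp [Finset.mul_sum, Finset.sum_mul, HopfAlgebra.antipode_mul_antidistrib, mul_assoc]

lemma sum_mul_comm_mul (hR : IsQuasiTriangular K H R) (hs : R = ∑ j ∈ s, j.1 ⊗ₜ j.2)
    (u v : H) : ∑ j ∈ s,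
      1 ⊗ₜ j.1 * (TensorProduct.comm K H H R * v ⊗ₜ u) * HopfAlgebra.antipode K j.2 ⊗ₜ 1 =
      ∑ j ∈ s, adEnd K H j.2 v ⊗ₜ (j.1 * u) := by
  have hv (a : H) : mulAntipode K H (((LinearMap.mul K H).flip v).rTensor H (comul a)) =
      adEnd K H a v := by
    rw [adEnd_apply (ℛ K a), ← (ℛ K a).eq]
    simp
  have h := congrArg ((TensorProduct.comm K H H).toLinearMap ∘ₗ
    TensorProduct.map ((LinearMap.mul K H).flip u)
      (mulAntipode K H ∘ₗ ((LinearMap.mul K H).flip v).rTensor H)) (hR.sum_tmul_comul hs)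
  simp only [map_sum, LinearMap.comp_apply, LinearEquiv.coe_coe,
    TensorProduct.map_tmul, hv, TensorProduct.comm_tmul,
    LinearMap.rTensor_tmul, mulAntipode_tmul, LinearMap.flip_apply,
    LinearMap.mul_apply'] at h
  conv_lhs => rw [hs]
  rw [h]
  simp [Finset.mul_sum, Finset.sum_mul, mul_assoc]

/-- The second formula `Δ_R(h) = Σ R² ·_ad h₍₂₎ ⊗ R¹ h₍₁₎` for the transmuted comultiplication. -/
lemma deltaR_eq_sum (hR : IsQuasiTriangular K H R) (hs : R = ∑ j ∈ s, j.1 ⊗ₜ j.2) (h : H) :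
    deltaR K H R h = ∑ j ∈ s, TensorProduct.map (adEnd K H j.2) (leftMul K H j.1)
      (TensorProduct.comm K H H (comul h)) := by
  have h1 : comul h * TensorProduct.comm K H H R =
      TensorProduct.comm K H H R * TensorProduct.comm K H H (comul h) := by
    have := congrArg (Algebra.TensorProduct.comm K H H) (hR.intertwine h)
    rw [map_mul, map_mul] at this
    have h2 : TensorProduct.comm K H H (TensorProduct.comm K H H (comul h)) = comul h := by
      rw [← LinearEquiv.trans_apply, TensorProduct.comm_trans_comm, LinearEquiv.refl_apply]
    exact (this.trans (congrArg (· * _) h2)).symm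
  have h3 (z : H ⊗[K] H) : twistHom K H R z = ∑ j ∈ s,
      1 ⊗ₜ j.1 * (z * TensorProduct.comm K H H R) * HopfAlgebra.antipode K j.2 ⊗ₜ 1 := by
    induction z with
    | zero => simp
    | add z w hz hw => simp only [map_add, hz, hw, add_mul, mul_add, Finset.sum_add_distrib]
    | tmul u v => exact twistHom_apply_tmul hR hs u v
  have h4 (z : H ⊗[K] H) : ∑ j ∈ s,
      1 ⊗ₜ j.1 * (TensorProduct.comm K H H R * z) * HopfAlgebra.antipode K j.2 ⊗ₜ 1 =
      ∑ j ∈ s, TensorProduct.map (adEnd K H j.2) (leftMul K H j.1) z := by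
    induction z with
    | zero => simp
    | add z w hz hw => simp only [map_add, ← hz, ← hw, add_mul, mul_add, Finset.sum_add_distrib]
    | tmul v u => simpa using sum_mul_comm_mul hR hs u v
  rw [deltaR_eq_twistHom, h3, h1, h4]

lemma isAdjointStableSubcoalgebra_iff (hR : IsQuasiTriangular K H R) (D : Submodule K H) :
    IsAdjointStableSubcoalgebra K H R D ↔ IsYDSubmodule K H D := by
  refine ⟨fun hD => ⟨hD.1, fun x hx => ?_⟩, fun hD => ⟨hD.1, fun x hx => ?_⟩⟩ <;>
    have had : ∀ h, ∀ a ∈ D, adEnd K H h a ∈ D := fun h a ha => adAct_eq (K := K) h a ▸ hD.1 h a ha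
  · rw [comul_eq_twistHom hR]
    exact twistHom_mem_map₂_top had _ (Submodule.map₂_le_map₂_left le_top (hD.2 x hx))
  · obtain ⟨s, hs⟩ := TensorProduct.exists_finset R
    obtain ⟨q, hq⟩ := D.subtype.exists_leftInverse_of_injective D.ker_subtype
    let p : H →ₗ[K] H := D.subtype ∘ₗ q
    have hp : ∀ x ∈ D, p x = LinearMap.id (R := K) x := fun x hx =>
      congrArg Subtype.val (LinearMap.congr_fun hq (⟨x, hx⟩ : D))
    have h1 : p.lTensor H (deltaR K H R x) = deltaR K H R x := by
      have := lTensor_congr_of_mem_map₂_top hp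
        (z := deltaR K H R x) (deltaR_eq_twistHom (R := R) x ▸
          twistHom_mem_map₂_top had R (hD.2 x hx))
      simpa using this
    have h2 : p.rTensor H (deltaR K H R x) = deltaR K H R x := by
      have := map_mem_of_mem_map₂_top (N := ⊥) (hD.2 x hx)
        ((p.rTensor H - LinearMap.id) ∘ₗ ∑ j ∈ s,
          TensorProduct.map (adEnd K H j.2) (leftMul K H j.1) ∘ₗ
          (TensorProduct.comm K H H).toLinearMap) fun a d hd => by
            simp [hp _ (had _ d hd)]
      simpa [sub_eq_zero, deltaR_eq_sum hR hs] using this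
    have h3 (z : H ⊗[K] H) : p.rTensor H (p.lTensor H z) ∈
        Submodule.map₂ (TensorProduct.mk K H H) D D := by
      induction z with
      | zero => simp
      | add z w hz hw => simpa using add_mem hz hw
      | tmul a b => exact Submodule.apply_mem_map₂ _ (q a).2 (q b).2
    rw [← h2, ← h1]
    exact h3 _

/-- Projections given by invariant functionals preserve every Yetter-Drinfeld submodule. -/
lemma dualAct_mem (hR : IsQuasiTriangular K H R) {e : H →ₗ[K] K}
    (he : ∀ h x, e (adEnd K H h x) = counit (R := K) h * e x) {D : Submodule K H}
    (hD : IsYDSubmodule K H D) {x : H} (hx : x ∈ D) : dualAct e x ∈ D := by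
  have h1 := ((isAdjointStableSubcoalgebra_iff hR D).2 hD).2 x hx
  have h2 : Submodule.map₂ (TensorProduct.mk K H H) D D ≤
      D.comap ((TensorProduct.rid K H).toLinearMap ∘ₗ e.lTensor H) :=
    Submodule.map₂_le.2 fun a ha b _ => by simpa using D.smul_mem _ ha
  rw [← rid_lTensor_deltaR hR he]
  exact h2 h1

end QuasiTriangular

section YetterDrinfeld

open Coalgebra

variable {K : Type} [Field K] {H : Type} [Ring H] [HopfAlgebra K H]
variable {R : H ⊗[K] H}

lemma intertwines_dualAct {e : H →ₗ[K] K}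
    (he : ∀ h x, e (adEnd K H h x) = counit (R := K) h * e x) :
    Intertwines (dualAct e) (adEnd K H) (adEnd K H) := by
  have h1 (f : H →ₗ[K] Module.End K H) :
      Intertwines ((TensorProduct.rid K H).toLinearMap ∘ₗ e.lTensor H)
        ((onFst K H).toLinearMap ∘ₗ f) f := by
    intro h z
    induction z with
    | zero => simp
    | add z w hz hw => simp only [map_add, hz, hw]
    | tmul a b => simp
  have h2 : Intertwines ((TensorProduct.rid K H).toLinearMap ∘ₗ e.lTensor H)
      ((onSnd K H).toLinearMap ∘ₗ adEnd K H) (convUnit K H (Module.End K H)) := by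
    intro h z
    induction z with
    | zero => simp
    | add z w hz hw => simp only [map_add, hz, hw]
    | tmul a b => simp [he, convUnit_apply, smul_smul, mul_comm]
  have h3 := (h1 (leftMul K H)).conv (h2.conv (h1 (rightMulAntipode K H)))
  rw [convUnit_conv] at h3
  exact Intertwines.comp (G' := (TensorProduct.rid K H).toLinearMap ∘ₗ e.lTensor H) h3
    intertwines_comul

lemma comul_dualAct (e : H →ₗ[K] K) (x : H) :
    comul (dualAct e x) = (dualAct e).lTensor H (comul x) := by
  have h1 (z : H ⊗[K] H) (y : H) :
      ((TensorProduct.rid K H).toLinearMap ∘ₗ e.lTensor H).lTensor H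
        (TensorProduct.assoc K H H H (z ⊗ₜ y)) = e y • z := by
    induction z with
    | zero => simp
    | add z w hz hw => simp only [TensorProduct.add_tmul, map_add, hz, hw, smul_add]
    | tmul a b => simp
  have h2 : (dualAct e).lTensor H (comul x) =
      ((TensorProduct.rid K H).toLinearMap ∘ₗ e.lTensor H).lTensor H
        (comul.lTensor H (comul x)) :=
    LinearMap.lTensor_comp_apply H ((TensorProduct.rid K H).toLinearMap ∘ₗ e.lTensor H) comul _
  rw [h2, ← coassoc_apply, dualAct_apply (ℛ K x)]
  conv_rhs => rw [← (ℛ K x).eq]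
  simp only [map_sum, LinearMap.rTensor_tmul, h1, map_smul]

/-- Every Yetter-Drinfeld submodule `D` has a Yetter-Drinfeld complement, and the associated
projection onto `D` preserves all Yetter-Drinfeld submodules. -/
lemma exists_isYDSubmodule_isCompl [FiniteDimensional K H] (hR : IsQuasiTriangular K H R)
    (hss : IsSemisimpleRing H) (hcoss : IsCosemisimpleCoalgebra K H) {D : Submodule K H}
    (hD : IsYDSubmodule K H D) :
    ∃ P : Module.End K H, IsYDSubmodule K H (LinearMap.ker P) ∧ IsCompl D (LinearMap.ker P) ∧
      (∀ x, P x ∈ D) ∧ (∀ x ∈ D, P x = x) ∧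
      ∀ D', IsYDSubmodule K H D' → ∀ x ∈ D', P x ∈ D' := by
  obtain ⟨e, he, hPD, hP⟩ := exists_invariant_functional hss hcoss hD
  refine ⟨dualAct e, ⟨fun h a ha => ?_, fun a ha => ?_⟩, ?_, hPD, hP,
    fun D' hD' x hx => dualAct_mem hR he hD' hx⟩
  · rw [LinearMap.mem_ker, adAct_eq, intertwines_dualAct he, LinearMap.mem_ker.1 ha, map_zero]
  · have h1 : (LinearMap.id - dualAct e).lTensor H (comul a) = comul a := by
      rw [LinearMap.lTensor_sub, LinearMap.sub_apply, ← comul_dualAct, LinearMap.mem_ker.1 ha]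
      simp
    rw [← h1]
    exact lTensor_mem_map₂_top (fun x => by simp [hP _ (hPD x)]) _
  · refine ⟨disjoint_iff.2 ?_, codisjoint_iff.2 ?_⟩
    · refine (Submodule.eq_bot_iff _).2 fun x hx => ?_
      rw [← hP x hx.1]
      exact hx.2
    · refine Submodule.eq_top_iff'.2 fun x => ?_
      rw [← add_sub_cancel (dualAct e x) x]
      exact Submodule.add_mem_sup (hPD x) (by simp [hP _ (hPD x)])

lemma isYDSubmodule_sSup {𝒟 : Set (Submodule K H)} (h𝒟 : ∀ D ∈ 𝒟, IsYDSubmodule K H D) :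
    IsYDSubmodule K H (sSup 𝒟) := by
  refine ⟨fun h => ?_, ?_⟩
  · simp only [adAct_eq]
    change sSup 𝒟 ≤ (sSup 𝒟).comap (adEnd K H h)
    refine sSup_le fun D hD x hx => ?_
    rw [Submodule.mem_comap, ← adAct_eq]
    exact le_sSup hD ((h𝒟 D hD).1 h x hx)
  · change sSup 𝒟 ≤ (Submodule.map₂ (TensorProduct.mk K H H) ⊤ (sSup 𝒟)).comap comul
    exact sSup_le fun D hD x hx =>
      Submodule.map₂_le_map₂_right (le_sSup hD) ((h𝒟 D hD).2 x hx)

/-- A nonzero Yetter-Drinfeld submodule contains a minimal one. -/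
lemma exists_isMinimalYDSubmodule_le [FiniteDimensional K H] {N : Submodule K H}
    (hN : IsYDSubmodule K H N) (h0 : N ≠ ⊥) : ∃ M ≤ N, IsMinimalYDSubmodule K H M := by
  obtain ⟨M, ⟨hMN, hM, hM0⟩, hmin⟩ := wellFounded_lt.has_min
    {M : Submodule K H | M ≤ N ∧ IsYDSubmodule K H M ∧ M ≠ ⊥} ⟨N, le_rfl, hN, h0⟩
  refine ⟨M, hMN, hM0, hM, fun D hDM hD => or_iff_not_imp_left.2 fun hD0 => ?_⟩
  by_contra hne
  exact hmin D ⟨hDM.trans hMN, hD, hD0⟩ (lt_of_le_of_ne hDM hne)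

/-- A minimal Yetter-Drinfeld submodule has a complement containing all other minimal ones. -/
lemma exists_isCompl_of_isMinimalYDSubmodule [FiniteDimensional K H]
    (hR : IsQuasiTriangular K H R) (hss : IsSemisimpleRing H)
    (hcoss : IsCosemisimpleCoalgebra K H) {M : Submodule K H}
    (hM : IsMinimalYDSubmodule K H M) :
    ∃ N, IsCompl M N ∧ ∀ M', IsMinimalYDSubmodule K H M' → M' ≠ M → M' ≤ N := by
  obtain ⟨P, -, hc, hPM, hP, hPD⟩ := exists_isYDSubmodule_isCompl hR hss hcoss hM.2.1
  refine ⟨LinearMap.ker P, hc, fun M' hM' hne x hx => ?_⟩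
  have hinf : IsYDSubmodule K H (M' ⊓ M) := by
    refine ⟨fun h a ha => ⟨hM'.2.1.1 h a ha.1, hM.2.1.1 h a ha.2⟩, fun a ha => ?_⟩
    have h1 := lTensor_congr_of_mem_map₂_top (f := P) (g := LinearMap.id) hP (hM.2.1.2 a ha.2)
    have h2 := map_mem_of_mem_map₂_top
      (N := Submodule.map₂ (TensorProduct.mk K H H) ⊤ (M' ⊓ M)) (hM'.2.1.2 a ha.1)
      (P.lTensor H) fun b d hd =>
        Submodule.apply_mem_map₂ _ trivial ⟨hPD M' hM'.2.1 d hd, hPM d⟩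
    simpa [h1] using h2
  have hbot : M' ⊓ M = ⊥ := by
    refine (hM'.2.2 _ inf_le_left hinf).resolve_right fun h1 => ?_
    rcases hM.2.2 _ (inf_eq_left.1 h1) hM'.2.1 with h2 | h2
    · exact hM'.1 h2
    · exact hne h2
  have : P x ∈ M' ⊓ M := ⟨hPD M' hM'.2.1 x hx, hPM x⟩
  rwa [hbot] at this

/-- `H` is in a unique way a direct sum of minimal Yetter-Drinfeld submodules. -/
lemma existsUnique_minimal_decomposition [FiniteDimensional K H]
    (hR : IsQuasiTriangular K H R) (hss : IsSemisimpleRing H)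
    (hcoss : IsCosemisimpleCoalgebra K H) :
    ∃! 𝒟 : Set (Submodule K H), 𝒟.Finite ∧ sSupIndep 𝒟 ∧ sSup 𝒟 = ⊤ ∧
      ∀ D ∈ 𝒟, IsMinimalYDSubmodule K H D := by
  have hind : sSupIndep {D | IsMinimalYDSubmodule K H D} := by
    intro M hM
    obtain ⟨N, hc, hN⟩ := exists_isCompl_of_isMinimalYDSubmodule hR hss hcoss hM
    exact hc.disjoint.mono_right (sSup_le fun M' hM' => hN M' hM'.1 hM'.2)
  refine ⟨{D | IsMinimalYDSubmodule K H D},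
    ⟨WellFoundedGT.finite_of_sSupIndep hind, hind, ?_, fun _ => id⟩, ?_⟩
  · obtain ⟨P, hYD, hc, -⟩ := exists_isYDSubmodule_isCompl hR hss hcoss
      (isYDSubmodule_sSup (𝒟 := {D | IsMinimalYDSubmodule K H D}) fun _ hD => hD.2.1)
    by_cases h0 : LinearMap.ker P = ⊥
    · simpa [h0] using hc.codisjoint
    · obtain ⟨M, hMP, hM⟩ := exists_isMinimalYDSubmodule_le hYD h0
      exact absurd (hc.disjoint (le_sSup hM) hMP) (by simpa using hM.1)
  · rintro 𝒟 ⟨-, -, htop, hmin⟩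
    refine Set.Subset.antisymm hmin fun M hM => ?_
    by_contra hM𝒟
    obtain ⟨N, hc, hN⟩ := exists_isCompl_of_isMinimalYDSubmodule hR hss hcoss hM
    have : N = ⊤ := top_le_iff.1 <| htop ▸ sSup_le fun D hD =>
      hN D (hmin D hD) fun h => hM𝒟 (h ▸ hD)
    exact hM.1 (by simpa [this] using hc.disjoint)

end YetterDrinfeld

/-- Let `(H,R)` be a finite dimensional semisimple and cosemisimple
quasi-triangular Hopf algebra.  Then there is a unique decomposition
`H_R = D₁ ⊕ ⋯ ⊕ D_r` of `H_R` into minimal `H`-adjoint-stable subcoalgebras, and the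
decompositions of `H_R` into minimal `H`-adjoint-stable subcoalgebras are exactly the
decompositions of `H` into irreducible Yetter–Drinfeld submodules (for the adjoint
action and the coproduct). -/
theorem unique_decomposition_into_minimal_adjoint_stable_subcoalgebras
    [FiniteDimensional K H]
    (R : H ⊗[K] H) (hR : IsQuasiTriangular K H R)
    (hss : IsSemisimpleRing H)
    (hcoss : IsCosemisimpleCoalgebra K H) :
    (∃! 𝒟 : Set (Submodule K H), 𝒟.Finite ∧ sSupIndep 𝒟 ∧ sSup 𝒟 = ⊤ ∧
        ∀ D ∈ 𝒟, IsMinimalAdjointStableSubcoalgebra K H R D) ∧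
    (∀ 𝒟 : Set (Submodule K H),
        (𝒟.Finite ∧ sSupIndep 𝒟 ∧ sSup 𝒟 = ⊤ ∧
          ∀ D ∈ 𝒟, IsMinimalAdjointStableSubcoalgebra K H R D) ↔
        (𝒟.Finite ∧ sSupIndep 𝒟 ∧ sSup 𝒟 = ⊤ ∧
          ∀ D ∈ 𝒟, IsMinimalYDSubmodule K H D)) := by
  have hmin (D : Submodule K H) :
      IsMinimalAdjointStableSubcoalgebra K H R D ↔ IsMinimalYDSubmodule K H D := by
    simp only [IsMinimalAdjointStableSubcoalgebra, IsMinimalYDSubmodule,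
      isAdjointStableSubcoalgebra_iff hR]
  simp only [hmin]
  exact ⟨existsUnique_minimal_decomposition hR hss hcoss, fun _ => trivial⟩
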